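/- arXiv:1910.03356 — 2 statements merged into one kernel-verified Lean document; each statement's English description precedes it below -/
import Mathlib

section
/- For every two-sided ideal T of P the following are equivalent: (1) T ≠ {0}; (2) C^M ∈ T for some positive integer M; (3) K ∈ T. -/
noncomputable section

/-- Generators of the algebra `P`. -/
inductive PGen : Type
  | K : PGen
  | A : PGen
  | B : PGen
  | C : PGen

/- The defining relations of the algebra `P`, where `q = p ^ 2`:
`(1 - q)AB = 1 - qC`, `(1 - q)BA = 1 - C`, `AC = qCA`, `qBC = CB` (i.e. `BC = q⁻¹CB`),
`pAK = KA` (i.e. `AK = p⁻¹KA`), `BK = pKB`, `CK = KC`, `K²C = 1`. -/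
open FreeAlgebra in
inductive PRel (p : ℂ) : FreeAlgebra ℂ PGen → FreeAlgebra ℂ PGen → Prop
  | ab : PRel p ((1 - p ^ 2) • (ι ℂ PGen.A * ι ℂ PGen.B)) (1 - p ^ 2 • ι ℂ PGen.C)
  | ba : PRel p ((1 - p ^ 2) • (ι ℂ PGen.B * ι ℂ PGen.A)) (1 - ι ℂ PGen.C)
  | ac : PRel p (ι ℂ PGen.A * ι ℂ PGen.C) (p ^ 2 • (ι ℂ PGen.C * ι ℂ PGen.A))
  | bc : PRel p (p ^ 2 • (ι ℂ PGen.B * ι ℂ PGen.C)) (ι ℂ PGen.C * ι ℂ PGen.B)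
  | ak : PRel p (p • (ι ℂ PGen.A * ι ℂ PGen.K)) (ι ℂ PGen.K * ι ℂ PGen.A)
  | bk : PRel p (ι ℂ PGen.B * ι ℂ PGen.K) (p • (ι ℂ PGen.K * ι ℂ PGen.B))
  | ck : PRel p (ι ℂ PGen.C * ι ℂ PGen.K) (ι ℂ PGen.K * ι ℂ PGen.C)
  | k2c : PRel p (ι ℂ PGen.K * ι ℂ PGen.K * ι ℂ PGen.C) 1

/-- The unital associative `ℂ`-algebra `P`, presented by generators `K, A, B, C`
and the relations above. -/
abbrev PAlg (p : ℂ) := RingQuot (PRel p)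

/-- The generator `K` of `P`. -/
def pK (p : ℂ) : PAlg p := RingQuot.mkAlgHom ℂ (PRel p) (FreeAlgebra.ι ℂ PGen.K)

/-- The generator `A` of `P`. -/
def pA (p : ℂ) : PAlg p := RingQuot.mkAlgHom ℂ (PRel p) (FreeAlgebra.ι ℂ PGen.A)

/-- The generator `B` of `P`. -/
def pB (p : ℂ) : PAlg p := RingQuot.mkAlgHom ℂ (PRel p) (FreeAlgebra.ι ℂ PGen.B)

/-- The generator `C` of `P`. -/
def pC (p : ℂ) : PAlg p := RingQuot.mkAlgHom ℂ (PRel p) (FreeAlgebra.ι ℂ PGen.C)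

open Polynomial

section Relations

variable (p : ℂ)

lemma pA_mul_pB : (1 - p ^ 2) • (pA p * pB p) = 1 - p ^ 2 • pC p := by
  simpa [pA, pB, pC] using RingQuot.mkAlgHom_rel ℂ (PRel.ab (p := p))

lemma pB_mul_pA : (1 - p ^ 2) • (pB p * pA p) = 1 - pC p := by
  simpa [pA, pB, pC] using RingQuot.mkAlgHom_rel ℂ (PRel.ba (p := p))

lemma smul_pA_mul_pK : p • (pA p * pK p) = pK p * pA p := by
  simpa [pA, pK] using RingQuot.mkAlgHom_rel ℂ (PRel.ak (p := p))

lemma pB_mul_pK : pB p * pK p = p • (pK p * pB p) := by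
  simpa [pB, pK] using RingQuot.mkAlgHom_rel ℂ (PRel.bk (p := p))

lemma pC_mul_pK : pC p * pK p = pK p * pC p := by
  simpa [pC, pK] using RingQuot.mkAlgHom_rel ℂ (PRel.ck (p := p))

lemma pK_mul_pK_mul_pC : pK p * pK p * pC p = 1 := by
  simpa [pC, pK] using RingQuot.mkAlgHom_rel ℂ (PRel.k2c (p := p))

lemma pA_mul_pK {p : ℂ} (hp : p ≠ 0) : pA p * pK p = p⁻¹ • (pK p * pA p) := by
  rw [← smul_pA_mul_pK, smul_smul, inv_mul_cancel₀ hp, one_smul]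

lemma pC_mul_pK_mul_pK : pC p * pK p * pK p = 1 := by
  rw [pC_mul_pK, mul_assoc, pC_mul_pK, ← mul_assoc, pK_mul_pK_mul_pC]

lemma isUnit_pK : IsUnit (pK p) :=
  isUnit_iff_exists.2 ⟨pK p * pC p, by rw [← mul_assoc, pK_mul_pK_mul_pC],
    by rw [← pC_mul_pK, pC_mul_pK_mul_pK]⟩

lemma isUnit_pC : IsUnit (pC p) :=
  isUnit_iff_exists.2 ⟨pK p * pK p, by rw [← mul_assoc, pC_mul_pK_mul_pK],
    pK_mul_pK_mul_pC p⟩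

lemma pK_sq_mul_pA_mul_pB {p : ℂ} (hq : 1 - p ^ 2 ≠ 0) :
    pK p ^ 2 * (pA p * pB p) =
      aeval (pK p) (C (1 - p ^ 2)⁻¹ * (X ^ 2 - C (p ^ 2)) : ℂ[X]) := by
  have h : pA p * pB p = (1 - p ^ 2)⁻¹ • (1 - p ^ 2 • pC p) := by
    rw [← pA_mul_pB, smul_smul, inv_mul_cancel₀ hq, one_smul]
  rw [h, mul_smul_comm, mul_sub, mul_smul_comm, pow_two (pK p), pK_mul_pK_mul_pC]
  simp [Algebra.smul_def, pow_two]

lemma pK_sq_mul_pB_mul_pA {p : ℂ} (hq : 1 - p ^ 2 ≠ 0) :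
    pK p ^ 2 * (pB p * pA p) =
      aeval (pK p) (C (1 - p ^ 2)⁻¹ * (X ^ 2 - 1) : ℂ[X]) := by
  have h : pB p * pA p = (1 - p ^ 2)⁻¹ • (1 - pC p) := by
    rw [← pB_mul_pA, smul_smul, inv_mul_cancel₀ hq, one_smul]
  rw [h, mul_smul_comm, mul_sub, pow_two (pK p), pK_mul_pK_mul_pC]
  simp [Algebra.smul_def, pow_two]

lemma pK_pow_mul_aeval (n : ℕ) (f : ℂ[X]) :
    pK p ^ n * aeval (pK p) f = aeval (pK p) f * pK p ^ n := by
  rw [← aeval_X_pow (R := ℂ) (pK p), ← map_mul, mul_comm, map_mul]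

end Relations

lemma mul_aeval_of_skew_commute {R : Type*} [Ring R] [Algebra ℂ R] {a k : R} {c : ℂ}
    (h : a * k = c • (k * a)) (f : ℂ[X]) :
    a * aeval k f = aeval k (f.comp (C c * X)) * a := by
  induction f using Polynomial.induction_on' with
  | add f g hf hg => simp [mul_add, add_mul, hf, hg]
  | monomial n r =>
    have key : a * k ^ n = c ^ n • (k ^ n * a) := by
      induction n with
      | zero => simp
      | succ n ih =>
        rw [pow_succ, ← mul_assoc, ih, smul_mul_assoc, mul_assoc, h, mul_smul_comm, smul_smul,
          ← mul_assoc, pow_succ]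
    rw [← C_mul_X_pow_eq_monomial]
    simp only [map_mul, aeval_C, aeval_X, map_pow, mul_comp, C_comp, pow_comp, X_comp, mul_pow]
    rw [← mul_assoc, ← Algebra.commutes, mul_assoc, key, Algebra.smul_def, map_pow]
    simp only [mul_assoc]

/-- The operators by which the generators of `P` act on functions `ℤ → ℂ`. -/
def pRepGen (p : ℂ) : PGen → Module.End ℂ (ℤ → ℂ)
  | PGen.K => LinearMap.pi fun n => p ^ n • LinearMap.proj n
  | PGen.A => LinearMap.pi fun n => LinearMap.proj (n - 1)
  | PGen.B => LinearMap.pi fun n =>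
      ((1 - p ^ 2)⁻¹ * (1 - p ^ (-2 * n))) • LinearMap.proj (n + 1)
  | PGen.C => LinearMap.pi fun n => p ^ (-2 * n) • LinearMap.proj n

/-- A representation of `P` on functions `ℤ → ℂ`. -/
def pRep {p : ℂ} (hp : p ≠ 0) (hq : 1 - p ^ 2 ≠ 0) : PAlg p →ₐ[ℂ] Module.End ℂ (ℤ → ℂ) :=
  RingQuot.liftAlgHom ℂ ⟨FreeAlgebra.lift ℂ (pRepGen p), by
    have e1 (n : ℤ) : p ^ (n + 1) = p ^ n * p := zpow_add_one₀ hp n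
    have e2 (n : ℤ) : p ^ (n - 1) = p ^ n * p⁻¹ := zpow_sub_one₀ hp n
    have e3 (n : ℤ) : p ^ (2 * n) = (p ^ n) ^ 2 := by
      rw [mul_comm, zpow_mul]; rfl
    have e4 (n : ℤ) : p ^ n ≠ 0 := zpow_ne_zero n hp
    rintro x y (_ | _)
    all_goals
      ext f n
      have := e4 n
      simp [pRepGen, e1, e2, e3]
      try field_simp
      try simp [e1, e2, e3]
      try field_simp⟩

lemma pAlg_nontrivial {p : ℂ} (hp : p ≠ 0) (hq : 1 - p ^ 2 ≠ 0) : Nontrivial (PAlg p) :=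
  (pRep hp hq).toRingHom.domain_nontrivial

/-- The monomial of weight `m`: `A ^ m` for `m ≥ 0` and `B ^ (-m)` for `m < 0`. -/
def pE (p : ℂ) : ℤ → PAlg p
  | Int.ofNat n => pA p ^ n
  | Int.negSucc n => pB p ^ (n + 1)

/-- The elements `∑ fₘ(K) Eₘ` with polynomial coefficients `fₘ`. -/
def polySpan (p : ℂ) : Submodule ℂ (PAlg p) :=
  ⨆ m : ℤ, LinearMap.range
    (LinearMap.mulRight ℂ (pE p m) ∘ₗ (aeval (pK p) : ℂ[X] →ₐ[ℂ] PAlg p).toLinearMap)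

section Span

variable {p : ℂ}

lemma aeval_mul_pE_mem (f : ℂ[X]) (m : ℤ) : aeval (pK p) f * pE p m ∈ polySpan p :=
  Submodule.mem_iSup_of_mem (p := fun m : ℤ => LinearMap.range
    (LinearMap.mulRight ℂ (pE p m) ∘ₗ (aeval (pK p) : ℂ[X] →ₐ[ℂ] PAlg p).toLinearMap)) m ⟨f, rfl⟩

lemma mul_mem_polySpan {a : PAlg p} (h : ∀ (f : ℂ[X]) m, a * (aeval (pK p) f * pE p m) ∈ polySpan p)
    {u : PAlg p} (hu : u ∈ polySpan p) : a * u ∈ polySpan p := by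
  have : polySpan p ≤ (polySpan p).comap (LinearMap.mulLeft ℂ a) := by
    refine iSup_le fun m => ?_
    rintro _ ⟨f, rfl⟩
    exact h f m
  exact this hu

lemma aeval_mul_mem_polySpan (g : ℂ[X]) {u : PAlg p} (hu : u ∈ polySpan p) :
    aeval (pK p) g * u ∈ polySpan p :=
  mul_mem_polySpan (fun f m => by
    rw [← mul_assoc, ← map_mul]; exact aeval_mul_pE_mem _ _) hu

lemma pK_pow_mul_mem_polySpan (n : ℕ) {u : PAlg p} (hu : u ∈ polySpan p) :
    pK p ^ n * u ∈ polySpan p := by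
  simpa using aeval_mul_mem_polySpan (X ^ n) hu

lemma pK_sq_mul_pA_mul_pE (hq : 1 - p ^ 2 ≠ 0) (m : ℤ) :
    ∃ g : ℂ[X], pK p ^ 2 * (pA p * pE p m) = aeval (pK p) g * pE p (m + 1) := by
  rcases m with n | n
  · exact ⟨X ^ 2, by
      rw [show Int.ofNat n + 1 = Int.ofNat (n + 1) from rfl]; simp [pE, pow_succ']⟩
  · refine ⟨C (1 - p ^ 2)⁻¹ * (X ^ 2 - C (p ^ 2)), ?_⟩
    have : pE p (Int.negSucc n + 1) = pB p ^ n := by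
      cases n with
      | zero => exact (pow_zero (pA p)).trans (pow_zero (pB p)).symm
      | succ n => rfl
    rw [this, ← pK_sq_mul_pA_mul_pB hq]
    simp [pE, pow_succ', mul_assoc]

lemma pK_sq_mul_pB_mul_pE (hq : 1 - p ^ 2 ≠ 0) (m : ℤ) :
    ∃ g : ℂ[X], pK p ^ 2 * (pB p * pE p m) = aeval (pK p) g * pE p (m - 1) := by
  rcases m with _ | n
  · rename_i n
    rcases n with _ | n
    · exact ⟨X ^ 2, by
        rw [show Int.ofNat 0 - 1 = Int.negSucc 0 from rfl]; simp [pE]⟩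
    · refine ⟨C (1 - p ^ 2)⁻¹ * (X ^ 2 - 1), ?_⟩
      have : Int.ofNat (n + 1) - 1 = Int.ofNat n := by simp
      rw [this, ← pK_sq_mul_pB_mul_pA hq]
      simp [pE, pow_succ', mul_assoc]
  · exact ⟨X ^ 2, by
      rw [show Int.negSucc n - 1 = Int.negSucc (n + 1) from rfl]; simp [pE, pow_succ']⟩

lemma pK_sq_mul_mul_mem_polySpan {a : PAlg p} {c : ℂ} {d : ℤ}
    (ha : a * pK p = c • (pK p * a))
    (h : ∀ m, ∃ g : ℂ[X], pK p ^ 2 * (a * pE p m) = aeval (pK p) g * pE p (m + d))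
    {u : PAlg p} (hu : u ∈ polySpan p) : pK p ^ 2 * a * u ∈ polySpan p := by
  refine mul_mem_polySpan (fun f m => ?_) hu
  obtain ⟨g, hg⟩ := h m
  rw [mul_assoc, ← mul_assoc a, mul_aeval_of_skew_commute ha, mul_assoc, ← mul_assoc (pK p ^ 2),
    pK_pow_mul_aeval, mul_assoc, hg, ← mul_assoc, ← map_mul]
  exact aeval_mul_pE_mem _ _

/-- The elements that some power of `K` multiplies into `polySpan p`. -/
def polySpanLocalized (p : ℂ) : Submodule ℂ (PAlg p) where
  carrier := {x | ∃ N : ℕ, pK p ^ N * x ∈ polySpan p}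
  zero_mem' := ⟨0, by simp⟩
  add_mem' := by
    rintro x y ⟨N, hN⟩ ⟨M, hM⟩
    refine ⟨M + N, ?_⟩
    rw [mul_add]
    refine add_mem ?_ ?_
    · rw [pow_add, mul_assoc]
      exact pK_pow_mul_mem_polySpan M hN
    · rw [add_comm, pow_add, mul_assoc]
      exact pK_pow_mul_mem_polySpan N hM
  smul_mem' := by
    rintro c x ⟨N, hN⟩
    exact ⟨N, by rw [mul_smul_comm]; exact Submodule.smul_mem _ c hN⟩

lemma mul_mem_polySpanLocalized {a : PAlg p} {c : ℂ} (hc : c ≠ 0)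
    (ha : a * pK p = c • (pK p * a))
    (h : ∀ u ∈ polySpan p, pK p ^ 2 * a * u ∈ polySpan p)
    {x : PAlg p} (hx : x ∈ polySpanLocalized p) : a * x ∈ polySpanLocalized p := by
  obtain ⟨N, hN⟩ := hx
  refine ⟨2 + N, ?_⟩
  have key : a * pK p ^ N = c ^ N • (pK p ^ N * a) := by
    have := mul_aeval_of_skew_commute ha (X ^ N)
    simpa [mul_pow, Algebra.smul_def, mul_assoc] using this
  have := h _ hN
  rw [mul_assoc, ← mul_assoc a, key, smul_mul_assoc, mul_smul_comm] at this
  simpa [pow_add, mul_assoc] using (Submodule.smul_mem_iff _ (pow_ne_zero N hc)).1 this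

lemma exists_pK_pow_mul_mem_polySpan (hp : p ≠ 0) (hq : 1 - p ^ 2 ≠ 0) (x : PAlg p) :
    ∃ N : ℕ, pK p ^ N * x ∈ polySpan p := by
  suffices H : ∀ a : FreeAlgebra ℂ PGen, ∀ x ∈ polySpanLocalized p,
      RingQuot.mkAlgHom ℂ (PRel p) a * x ∈ polySpanLocalized p by
    obtain ⟨a, rfl⟩ := RingQuot.mkAlgHom_surjective ℂ (PRel p) x
    have h1 : (1 : PAlg p) ∈ polySpanLocalized p :=
      ⟨0, by simpa [pE] using aeval_mul_pE_mem (p := p) 1 (Int.ofNat 0)⟩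
    have h2 := H a 1 h1
    rwa [mul_one] at h2
  intro a
  induction a using FreeAlgebra.induction with
  | grade0 r =>
    intro x hx
    rw [AlgHom.commutes, ← Algebra.smul_def]
    exact Submodule.smul_mem _ r hx
  | mul a b iha ihb =>
    intro x hx
    rw [map_mul, mul_assoc]
    exact iha _ (ihb _ hx)
  | add a b iha ihb =>
    intro x hx
    rw [map_add, add_mul]
    exact add_mem (iha _ hx) (ihb _ hx)
  | grade1 g =>
    intro x hx
    cases g with
    | K =>
      obtain ⟨N, hN⟩ := hx
      refine ⟨N, ?_⟩
      have := pK_pow_mul_mem_polySpan 1 hN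
      rwa [← mul_assoc, ← pow_add, add_comm, pow_succ, mul_assoc] at this
    | C =>
      obtain ⟨N, hN⟩ := hx
      refine ⟨N + 2, ?_⟩
      change pK p ^ (N + 2) * (pC p * x) ∈ _
      rwa [pow_add, pow_two, mul_assoc, ← mul_assoc _ _ x, pK_mul_pK_mul_pC, one_mul]
    | A =>
      exact mul_mem_polySpanLocalized (inv_ne_zero hp) (pA_mul_pK hp)
        (fun u hu => pK_sq_mul_mul_mem_polySpan (pA_mul_pK hp) (pK_sq_mul_pA_mul_pE hq) hu) hx
    | B =>
      exact mul_mem_polySpanLocalized hp (pB_mul_pK p)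
        (fun u hu => pK_sq_mul_mul_mem_polySpan (d := -1) (pB_mul_pK p)
          (pK_sq_mul_pB_mul_pE hq) hu) hx

end Span

section Ideal

variable {p : ℂ} (T : TwoSidedIdeal (PAlg p))

lemma TwoSidedIdeal.smul_mem_of_algebra {R : Type*} [Ring R] [Algebra ℂ R]
    (T : TwoSidedIdeal R) (c : ℂ) {x : R} (hx : x ∈ T) : c • x ∈ T := by
  rw [Algebra.smul_def]
  exact T.mul_mem_left _ _ hx

lemma TwoSidedIdeal.mem_of_isUnit_mul_mem {R : Type*} [Ring R] (T : TwoSidedIdeal R)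
    {u x : R} (hu : IsUnit u) (hx : u * x ∈ T) : x ∈ T := by
  obtain ⟨v, rfl⟩ := hu
  simpa using T.mul_mem_left (↑v⁻¹) _ hx

/-- Components of distinct weights of an element of a two-sided ideal lie in the ideal. -/
lemma weight_component_mem {R : Type*} [Ring R] [Algebra ℂ R] (T : TwoSidedIdeal R) {k : R}
    (hk : IsUnit k) {ι : Type*} {χ : ι → ℂ} (hχ : Function.Injective χ) (s : Finset ι) :
    ∀ w : ι → R, (∀ m, k * w m = χ m • (w m * k)) → ∑ m ∈ s, w m ∈ T → ∀ m ∈ s, w m ∈ T := by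
  classical
  obtain ⟨v, rfl⟩ := hk
  induction s using Finset.induction_on with
  | empty => simp
  | insert a s ha ih =>
    intro w hw hsum
    have hs : ∀ m ∈ s, w m ∈ T := by
      intro m hm
      have h2 : ∑ m ∈ s, (χ m - χ a) • w m ∈ T := by
        have e : ∑ m ∈ s, (χ m - χ a) • w m =
            v * (∑ m ∈ insert a s, w m) * ↑v⁻¹ - χ a • ∑ m ∈ insert a s, w m := by
          have e1 : (v : R) * (∑ m ∈ insert a s, w m) * ↑v⁻¹ =
              ∑ m ∈ insert a s, χ m • w m := by
            rw [Finset.mul_sum, Finset.sum_mul]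
            refine Finset.sum_congr rfl fun m _ => ?_
            rw [hw, smul_mul_assoc, Units.mul_inv_cancel_right]
          rw [e1, Finset.smul_sum, ← Finset.sum_sub_distrib, Finset.sum_insert ha]
          simp [sub_smul]
        rw [e]
        exact T.sub_mem (T.mul_mem_right _ _ (T.mul_mem_left _ _ hsum))
          (T.smul_mem_of_algebra _ hsum)
      have h3 := ih (fun m => (χ m - χ a) • w m) (fun m => by
        rw [mul_smul_comm, hw, smul_mul_assoc, smul_comm]) h2 m hm
      have hne : χ m - χ a ≠ 0 := sub_ne_zero.2 (hχ.ne (by rintro rfl; exact ha hm))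
      simpa [smul_smul, inv_mul_cancel₀ hne] using T.smul_mem_of_algebra (χ m - χ a)⁻¹ h3
    intro m hm
    rcases Finset.mem_insert.1 hm with rfl | hm
    · rw [Finset.sum_insert ha] at hsum
      simpa using T.sub_mem hsum (sum_mem hs)
    · exact hs m hm

lemma pK_mul_pE (hp : p ≠ 0) (m : ℤ) : pK p * pE p m = p ^ m • (pE p m * pK p) := by
  have key {a : PAlg p} {c : ℂ} (h : pK p * a = c • (a * pK p)) (n : ℕ) :
      pK p * a ^ n = c ^ n • (a ^ n * pK p) := by
    induction n with
    | zero => simp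
    | succ n ih =>
      rw [pow_succ, ← mul_assoc, ih, smul_mul_assoc, mul_assoc, h, mul_smul_comm, smul_smul,
        ← mul_assoc, pow_succ]
  rcases m with n | n
  · simpa [pE] using key (smul_pA_mul_pK p).symm n
  · have hB : pK p * pB p = p⁻¹ • (pB p * pK p) := by
      rw [pB_mul_pK, smul_smul, inv_mul_cancel₀ hp, one_smul]
    simpa [pE, zpow_negSucc] using key hB (n + 1)

/-- The polynomials `f` with `f(K) ∈ T`. -/
def pKIdeal : Ideal ℂ[X] where
  carrier := {f | aeval (pK p) f ∈ T}
  zero_mem' := by simp [T.zero_mem]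
  add_mem' := by
    intro f g hf hg
    simpa using T.add_mem hf hg
  smul_mem' := by
    intro f g hg
    simpa using T.mul_mem_left _ _ hg

variable {T}

lemma mem_pKIdeal {f : ℂ[X]} : f ∈ pKIdeal T ↔ aeval (pK p) f ∈ T := Iff.rfl

/-- Powers on the right can be removed at the cost of a nonzero polynomial factor. -/
lemma exists_mem_pKIdeal_of_mul_pow {a b : PAlg p} {c : ℂ} (hc : c ≠ 0)
    (ha : a * pK p = c • (pK p * a)) {g : ℂ[X]} (hg : g ≠ 0)
    (hab : pK p ^ 2 * (a * b) = aeval (pK p) g) (n : ℕ) :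
    ∀ f : ℂ[X], f ≠ 0 → aeval (pK p) f * a ^ n ∈ T → ∃ h ≠ 0, h ∈ pKIdeal T := by
  induction n with
  | zero => exact fun f hf hT => ⟨f, hf, by simpa [mem_pKIdeal] using hT⟩
  | succ n ih =>
    intro f hf hT
    have han : a ^ n * pK p = c ^ n • (pK p * a ^ n) := by
      clear ih hT
      induction n with
      | zero => simp
      | succ n ih =>
        rw [pow_succ', mul_assoc, ih, mul_smul_comm, ← mul_assoc, ha, smul_mul_assoc, smul_smul,
          mul_assoc, pow_succ]
    refine ih (f * g.comp (C (c ^ n) * X)) (mul_ne_zero hf ?_) ?_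
    · rwa [Ne, comp_C_mul_X_eq_zero_iff (by simpa using pow_ne_zero n hc)]
    · have hK : a ^ n * pK p ^ 2 = (c ^ n) ^ 2 • (pK p ^ 2 * a ^ n) := by
        have := mul_aeval_of_skew_commute han (X ^ 2)
        simpa [mul_pow, Algebra.smul_def, mul_assoc] using this
      have e : aeval (pK p) (f * g.comp (C (c ^ n) * X)) * a ^ n =
          (c ^ n) ^ 2 • (pK p ^ 2 * (aeval (pK p) f * a ^ (n + 1) * b)) := by
        rw [map_mul, mul_assoc, ← mul_aeval_of_skew_commute han, ← hab, ← mul_assoc (a ^ n), hK,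
          smul_mul_assoc, mul_smul_comm, mul_assoc (pK p ^ 2), ← mul_assoc (aeval (pK p) f),
          ← pK_pow_mul_aeval]
        simp only [pow_succ, mul_assoc]
      rw [e]
      exact T.smul_mem_of_algebra _ (T.mul_mem_left _ _ (T.mul_mem_right _ _ hT))

lemma X_sq_sub_C_ne_zero (r : ℂ) : (X ^ 2 - C r : ℂ[X]) ≠ 0 :=
  X_pow_sub_C_ne_zero two_pos r

/-- A nonzero two-sided ideal contains a nonzero polynomial in `K`. -/
lemma exists_ne_zero_mem_pKIdeal (hp : p ≠ 0) (hpn : ∀ n : ℤ, p ^ n = 1 → n = 0)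
    (hT : ∃ x ∈ T, x ≠ 0) : ∃ h ≠ 0, h ∈ pKIdeal T := by
  have hq : 1 - p ^ 2 ≠ 0 := fun h => by
    simpa using hpn 2 (by exact_mod_cast (sub_eq_zero.1 h).symm)
  obtain ⟨x, hxT, hx⟩ := hT
  obtain ⟨N, hN⟩ := exists_pK_pow_mul_mem_polySpan hp hq x
  obtain ⟨w, hw, hsum⟩ := (Submodule.mem_iSup_iff_exists_finsupp _ _).1 hN
  have hsT : ∑ m ∈ w.support, w m ∈ T := by
    change w.sum (fun _ y => y) ∈ T
    rw [hsum]
    exact T.mul_mem_left _ _ hxT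
  have hinj : Function.Injective fun m : ℤ => p ^ m := fun m n hmn => by
    refine sub_eq_zero.1 (hpn _ ?_)
    rw [zpow_sub₀ hp, show p ^ m = p ^ n from hmn, div_self (zpow_ne_zero _ hp)]
  have hwT := weight_component_mem T (isUnit_pK p) hinj w.support w (fun m => by
    obtain ⟨f, hf⟩ := hw m
    rw [← hf]
    have hc : pK p * aeval (pK p) f = aeval (pK p) f * pK p := by
      simpa using pK_pow_mul_aeval p 1 f
    change pK p * (aeval (pK p) f * pE p m) = p ^ m • (aeval (pK p) f * pE p m * pK p)
    rw [← mul_assoc, hc, mul_assoc, pK_mul_pE hp, mul_smul_comm, mul_assoc]) hsT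
  have hne : w.support.Nonempty := by
    rw [Finset.nonempty_iff_ne_empty]
    intro h0
    have : w = 0 := Finsupp.support_eq_empty.1 h0
    rw [this, Finsupp.sum_zero_index] at hsum
    exact hx ((((isUnit_pK p).pow N).mul_right_eq_zero).1 hsum.symm)
  obtain ⟨m, hm⟩ := hne
  obtain ⟨f, hf⟩ := hw m
  have hmT := hwT m hm
  have hf0 : f ≠ 0 := by
    rintro rfl
    exact Finsupp.mem_support_iff.1 hm (by simpa using hf.symm)
  rw [← hf] at hmT
  have hr : (C (1 - p ^ 2)⁻¹ : ℂ[X]) ≠ 0 := C_ne_zero.2 (inv_ne_zero hq)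
  rcases m with n | n
  · exact exists_mem_pKIdeal_of_mul_pow (inv_ne_zero hp) (pA_mul_pK hp)
      (mul_ne_zero hr (X_sq_sub_C_ne_zero _)) (pK_sq_mul_pA_mul_pB hq) n f hf0 hmT
  · exact exists_mem_pKIdeal_of_mul_pow hp (pB_mul_pK p)
      (mul_ne_zero hr (by simpa using X_sq_sub_C_ne_zero 1)) (pK_sq_mul_pB_mul_pA hq)
      (n + 1) f hf0 hmT

lemma comp_mul_mem_pKIdeal {a b : PAlg p} {c : ℂ} (ha : a * pK p = c • (pK p * a)) {g : ℂ[X]}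
    (hab : pK p ^ 2 * (a * b) = aeval (pK p) g) {f : ℂ[X]} (hf : f ∈ pKIdeal T) :
    f.comp (C c * X) * g ∈ pKIdeal T := by
  rw [mem_pKIdeal, map_mul, ← hab, ← mul_assoc, ← pK_pow_mul_aeval, mul_assoc, ← mul_assoc _ a,
    ← mul_aeval_of_skew_commute ha]
  exact T.mul_mem_left _ _ (T.mul_mem_right _ _ (T.mul_mem_left _ _ hf))

/-- A nonzero polynomial has no orbit of nonzero roots under scaling by `c`
of infinite order. -/
lemma exists_not_isRoot_pow_mul {h : ℂ[X]} (hh : h ≠ 0) {c z : ℂ} (hz : z ≠ 0)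
    (hc : Function.Injective fun k : ℕ => c ^ k) : ∃ k : ℕ, ¬ h.IsRoot (c ^ k * z) := by
  by_contra! H
  refine Set.infinite_of_injective_forall_mem (s := {x | h.IsRoot x})
    (f := fun k : ℕ => c ^ k * z) (fun k l hkl => hc (mul_right_cancel₀ hz hkl)) H ?_
  exact finite_setOfPred_isRoot hh

/-- The algebra `P` is simple when `p` is not a root of unity. -/
lemma one_mem_of_exists_ne_zero (hp : p ≠ 0) (hpn : ∀ n : ℤ, p ^ n = 1 → n = 0)
    (hT : ∃ x ∈ T, x ≠ 0) : (1 : PAlg p) ∈ T := by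
  have hq : 1 - p ^ 2 ≠ 0 := fun h => by
    simpa using hpn 2 (by exact_mod_cast (sub_eq_zero.1 h).symm)
  have hinj : Function.Injective fun k : ℕ => p ^ k := fun m n hmn => by
    have := hpn (m - n) (by
      rw [zpow_sub₀ hp, zpow_natCast, zpow_natCast, show p ^ m = p ^ n from hmn,
        div_self (pow_ne_zero _ hp)])
    omega
  have hinj' : Function.Injective fun k : ℕ => p⁻¹ ^ k := fun m n hmn =>
    hinj (by simpa using hmn)
  obtain ⟨f, hf0, hf⟩ := exists_ne_zero_mem_pKIdeal hp hpn hT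
  obtain ⟨h, hh⟩ := (IsPrincipalIdealRing.principal (pKIdeal T)).principal
  have hmem : h ∈ pKIdeal T := by rw [hh]; exact Submodule.mem_span_singleton_self h
  have hdvd {g : ℂ[X]} (hg : g ∈ pKIdeal T) : h ∣ g := by
    rw [hh] at hg
    exact Ideal.mem_span_singleton.1 hg
  have hh0 : h ≠ 0 := by
    rintro rfl
    exact hf0 (zero_dvd_iff.1 (hdvd hf))
  have hdown {z : ℂ} (hz : h.IsRoot z) (hzq : z ^ 2 ≠ p ^ 2) : h.IsRoot (p⁻¹ * z) := by
    have := hz.dvd (hdvd (comp_mul_mem_pKIdeal (pA_mul_pK hp) (pK_sq_mul_pA_mul_pB hq) hmem))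
    simpa [IsRoot.def, hq, sub_eq_zero, hzq] using this
  have hup {z : ℂ} (hz : h.IsRoot z) (hz1 : z ^ 2 ≠ 1) : h.IsRoot (p * z) := by
    have := hz.dvd (hdvd (comp_mul_mem_pKIdeal (pB_mul_pK p) (pK_sq_mul_pB_mul_pA hq) hmem))
    simpa [IsRoot.def, hq, sub_eq_zero, hz1] using this
  have hno : ∀ z, ¬ h.IsRoot z := by
    intro z hz
    by_cases hz0 : z = 0
    · subst hz0
      obtain ⟨g, hg⟩ := dvd_iff_isRoot.2 hz
      rw [C_0, sub_zero] at hg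
      have hgT : g ∈ pKIdeal T := by
        rw [hg, mem_pKIdeal, map_mul, aeval_X] at hmem
        exact T.mem_of_isUnit_mul_mem (isUnit_pK p) hmem
      have hg0 : g ≠ 0 := by rintro rfl; exact hh0 (by simpa using hg)
      have := natDegree_le_of_dvd (hdvd hgT) hg0
      rw [hg, natDegree_X_mul hg0] at this
      omega
    by_cases hzk : ∃ k : ℕ, z ^ 2 = (p ^ 2) ^ (k + 1)
    · obtain ⟨k, hk⟩ := hzk
      obtain ⟨j, hj⟩ := exists_not_isRoot_pow_mul hh0 hz0 hinj
      refine hj ?_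
      clear hj
      induction j with
      | zero => simpa using hz
      | succ j ih =>
        rw [pow_succ', mul_assoc]
        refine hup ih fun h1 => ?_
        have := hpn (2 * j + 2 * (k + 1) : ℕ) (by
          rw [zpow_natCast, ← h1, mul_pow, hk]; ring)
        omega
    · obtain ⟨j, hj⟩ := exists_not_isRoot_pow_mul hh0 hz0 hinj'
      refine hj ?_
      clear hj
      induction j with
      | zero => simpa using hz
      | succ j ih =>
        rw [pow_succ', mul_assoc]
        refine hdown ih fun h1 => hzk ⟨j, ?_⟩
        rw [mul_pow, inv_pow] at h1
        field_simp at h1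
        rw [h1]; ring
  have hu : IsUnit h := by
    rw [isUnit_iff_degree_eq_zero]
    by_contra hd
    obtain ⟨z, hz⟩ := IsAlgClosed.exists_root h hd
    exact hno z hz
  have h1 := (Ideal.eq_top_iff_one _).1 (Ideal.eq_top_of_isUnit_mem _ hmem hu)
  simpa [mem_pKIdeal] using h1

end Ideal

/-- For every two-sided ideal `T` of `P` (with `p = e^{-ω}`, `ω > 0`),
the following are equivalent: (1) `T ≠ {0}`; (2) `C^M ∈ T` for some positive integer `M`;
(3) `K ∈ T`. -/
theorem statement_11 (ω : ℝ) (hω : 0 < ω)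
    (T : TwoSidedIdeal (PAlg (Real.exp (-ω) : ℂ))) :
    ((∃ x ∈ T, x ≠ 0) ↔ ∃ M : ℕ, 1 ≤ M ∧ pC (Real.exp (-ω) : ℂ) ^ M ∈ T) ∧
    ((∃ x ∈ T, x ≠ 0) ↔ pK (Real.exp (-ω) : ℂ) ∈ T) := by
  have hp : (Real.exp (-ω) : ℂ) ≠ 0 := by exact_mod_cast (Real.exp_pos _).ne'
  have hpn : ∀ n : ℤ, (Real.exp (-ω) : ℂ) ^ n = 1 → n = 0 := by
    intro n hn
    have hr : Real.exp (-ω) ^ n = 1 := by exact_mod_cast hn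
    rw [← Real.rpow_intCast, ← Real.exp_mul, Real.exp_eq_one_iff] at hr
    rcases mul_eq_zero.1 hr with h | h
    · linarith
    · exact_mod_cast h
  have hq : 1 - (Real.exp (-ω) : ℂ) ^ 2 ≠ 0 := fun h => by
    simpa using hpn 2 (by exact_mod_cast (sub_eq_zero.1 h).symm)
  have := pAlg_nontrivial hp hq
  have key : (∃ x ∈ T, x ≠ 0) → ∀ y, y ∈ T := fun h y => by
    simpa using T.mul_mem_left y _ (one_mem_of_exists_ne_zero hp hpn h)
  exact ⟨⟨fun h => ⟨1, le_rfl, key h _⟩, fun ⟨M, _, hM⟩ => ⟨_, hM, ((isUnit_pC _).pow M).ne_zero⟩⟩,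
    ⟨fun h => key h _, fun h => ⟨_, h, (isUnit_pK _).ne_zero⟩⟩⟩
end
end

section
/- Let 𝒜 be a unital associative ℂ-algebra and Ψ : P → 𝒜 a unital ℂ-algebra homomorphism such that Ψ(C)^M ≠ 0 for every positive integer M. Then Ψ is injective. -/
noncomputable section

open Polynomial

theorem zpow_injective_of_pow_ne_one {F : Type*} [Field F] {x : F} (hx : x ≠ 0)
    (hx1 : ∀ n : ℕ, n ≠ 0 → x ^ n ≠ 1) : Function.Injective fun n : ℤ => x ^ n := by
  intro m n hmn
  have h1 : x ^ (m - n) = 1 := by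
    rw [zpow_sub₀ hx, div_eq_one_iff_eq (zpow_ne_zero n hx)]
    exact hmn
  obtain ⟨l, hl⟩ := Int.eq_nat_or_neg (m - n)
  have hxl : x ^ l = 1 := by
    obtain hl | hl := hl <;> simpa [hl] using h1
  have hl0 : l = 0 := by
    by_contra hne
    exact hx1 l hne hxl
  omega

section QCommuting

variable {R : Type*} [Ring R] [Algebra ℂ R] {k e : R} {s : ℂ}

theorem mul_aeval_of_qCommute (h : e * k = s • (k * e)) (f : ℂ[X]) :
    e * aeval k f = aeval k (f.comp (C s * X)) * e := by
  induction f using Polynomial.induction_on with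
  | C a => simp [Algebra.commutes]
  | add f g hf hg => simp [mul_add, add_mul, hf, hg]
  | monomial n a ih =>
    rw [pow_succ, ← mul_assoc, map_mul, ← mul_assoc, ih, mul_comp, map_mul, aeval_X, mul_assoc, h]
    simp [Algebra.smul_def, mul_assoc]

theorem pow_mul_of_qCommute (h : e * k = s • (k * e)) (n : ℕ) :
    e ^ n * k = s ^ n • (k * e ^ n) := by
  induction n with
  | zero => simp
  | succ n ih =>
    rw [pow_succ', mul_assoc, ih, mul_smul_comm, ← mul_assoc, h, smul_mul_assoc, smul_smul,
      mul_assoc, ← pow_succ]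

theorem mul_pow_of_qCommute (h : e * k = s • (k * e)) (n : ℕ) :
    e * k ^ n = s ^ n • (k ^ n * e) := by
  induction n with
  | zero => simp
  | succ n ih =>
    rw [pow_succ, ← mul_assoc, ih, smul_mul_assoc, mul_assoc, h, mul_smul_comm, smul_smul,
      mul_assoc, ← pow_succ]

theorem aeval_mul_eq_eval_smul {v : R} {μ : ℂ} (h : k * v = μ • v) (f : ℂ[X]) :
    aeval k f * v = f.eval μ • v := by
  induction f using Polynomial.induction_on with
  | C a => simp [Algebra.smul_def]
  | add f g hf hg => simp [add_mul, add_smul, hf, hg]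
  | monomial n a ih =>
    rw [pow_succ, ← mul_assoc, map_mul, aeval_X, mul_assoc, h, mul_smul_comm, ih, smul_smul,
      eval_mul_X, mul_comm]

theorem exists_eigenvector_of_isAlgebraic [Nontrivial R] (hk : IsAlgebraic ℂ k) :
    ∃ (μ : ℂ) (v : R), v ≠ 0 ∧ k * v = μ • v := by
  have hint : IsIntegral ℂ k := hk.isIntegral
  obtain ⟨μ, hμ⟩ := IsAlgClosed.exists_root _ (minpoly.degree_pos hint).ne'
  obtain ⟨r, hr⟩ := dvd_iff_isRoot.mpr hμ
  have hr0 : r ≠ 0 := by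
    rintro rfl
    exact minpoly.ne_zero hint (by simpa using hr)
  refine ⟨μ, aeval k r, fun h0 => ?_, ?_⟩
  · have h1 := minpoly.degree_le_of_ne_zero ℂ k hr0 h0
    rw [hr, degree_mul, degree_X_sub_C, degree_eq_natDegree hr0] at h1
    norm_cast at h1
    omega
  · have h1 := minpoly.aeval ℂ k
    rw [hr, map_mul, map_sub, aeval_X, aeval_C, sub_mul, sub_eq_zero, ← Algebra.smul_def] at h1
    exact h1

theorem exists_eigenvector_mul_eq_zero (h : e * k = s • (k * e)) (hs : s ≠ 0)
    (hs1 : ∀ n : ℕ, n ≠ 0 → s ^ n ≠ 1) (hk : IsAlgebraic ℂ k) {v : R} {μ : ℂ} (hμ : μ ≠ 0)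
    (hv : v ≠ 0) (hkv : k * v = μ • v) :
    ∃ (n : ℕ) (u : R), u ≠ 0 ∧ s ^ n • (k * u) = μ • u ∧ e * u = 0 := by
  have hkey (n : ℕ) : s ^ n • (k * (e ^ n * v)) = μ • (e ^ n * v) := by
    rw [← mul_assoc, ← smul_mul_assoc, ← pow_mul_of_qCommute h, mul_assoc, hkv, mul_smul_comm]
  have hex : ∃ n : ℕ, e ^ n * v = 0 := by
    by_contra! hne
    obtain ⟨f, hf, hfk⟩ := hk
    refine Set.infinite_of_injective_forall_mem (s := {x | IsRoot f x})
      (f := fun n : ℕ => (s ^ n)⁻¹ * μ) ?_ ?_ (finite_setOfPred_isRoot hf)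
    · intro m n hmn
      have hmn' : s ^ m = s ^ n := inv_injective (mul_right_cancel₀ hμ hmn)
      exact Int.ofNat_injective (zpow_injective_of_pow_ne_one hs hs1 (by simpa using hmn'))
    · intro n
      have h1 : k * (e ^ n * v) = ((s ^ n)⁻¹ * μ) • (e ^ n * v) := by
        rw [mul_smul, ← hkey, inv_smul_smul₀ (pow_ne_zero n hs)]
      have h2 := aeval_mul_eq_eval_smul h1 f
      rw [hfk, zero_mul] at h2
      exact (smul_eq_zero.mp h2.symm).resolve_right (hne n)
  classical
  obtain ⟨n, hn⟩ : ∃ n, Nat.find hex = n + 1 :=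
    Nat.exists_eq_succ_of_ne_zero fun h0 => hv (by simpa [h0] using Nat.find_spec hex)
  refine ⟨n, e ^ n * v, Nat.find_min hex (by omega), hkey n, ?_⟩
  have := Nat.find_spec hex
  rwa [hn, pow_succ', mul_assoc] at this

theorem eq_zero_of_aeval_mul_pow_eq_zero (h : e * k = s • (k * e)) (hk : Transcendental ℂ k)
    {e' : R} {α β : ℂ} (hβ : β ≠ 0) (he : e * e' * (k * k) = α • (k * k) - β • 1)
    (n : ℕ) {f : ℂ[X]} (hf : aeval k f * e ^ n = 0) : f = 0 := by
  induction n generalizing f with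
  | zero => exact transcendental_iff.mp hk f (by simpa using hf)
  | succ n ih =>
    let g : ℂ[X] := C (α * (s ^ n) ^ 2) * X ^ 2 - C β
    have hg : g ≠ 0 := fun h0 => hβ (by simpa [g] using congrArg (eval 0) h0)
    have hn := pow_mul_of_qCommute h n
    have hgn : e ^ n * (α • (k * k) - β • 1) = aeval k g * e ^ n := by
      have hcomp : (C α * X ^ 2 - C β).comp (C (s ^ n) * X) = g := by
        simp [g, mul_pow, mul_assoc]
      have := mul_aeval_of_qCommute hn (C α * X ^ 2 - C β)
      rw [hcomp] at this
      rw [← this]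
      simp [pow_two, Algebra.smul_def]
    have h0 : aeval k (f * g) * e ^ n = 0 := by
      rw [map_mul, mul_assoc, ← hgn, ← he]
      simp only [← mul_assoc]
      rw [mul_assoc (aeval k f), ← pow_succ, hf]
      simp
    exact (mul_eq_zero.mp (ih h0)).resolve_right hg

end QCommuting

/-- Elements `k, a, b, c` of a `ℂ`-algebra satisfying the defining relations of `PAlg p`,
apart from the two relations commuting `c` past `a` and `b`, which follow from the others. -/
structure IsQOscillator {R : Type*} [Ring R] [Algebra ℂ R] (p : ℂ) (k a b c : R) : Prop where
  ab : (1 - p ^ 2) • (a * b) = 1 - p ^ 2 • c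
  ba : (1 - p ^ 2) • (b * a) = 1 - c
  ak : p • (a * k) = k * a
  bk : b * k = p • (k * b)
  ck : c * k = k * c
  k2c : k * k * c = 1

namespace IsQOscillator

variable {R : Type*} [Ring R] [Algebra ℂ R] {p : ℂ} {k a b c : R}

theorem ak_inv (h : IsQOscillator p k a b c) (hp : p ≠ 0) : a * k = p⁻¹ • (k * a) := by
  rw [← h.ak, inv_smul_smul₀ hp]

theorem isUnit_k (h : IsQOscillator p k a b c) : IsUnit k :=
  ⟨⟨k, k * c, by rw [← mul_assoc, h.k2c], by rw [mul_assoc, h.ck, ← mul_assoc, h.k2c]⟩, rfl⟩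

theorem ckk (h : IsQOscillator p k a b c) : c * (k * k) = 1 := by
  rw [← mul_assoc, h.ck, mul_assoc, h.ck, ← mul_assoc, h.k2c]

theorem transcendental_k [Nontrivial R] (h : IsQOscillator p k a b c) (hp : p ≠ 0)
    (hp1 : ∀ n : ℕ, n ≠ 0 → p ^ n ≠ 1) : Transcendental ℂ k := by
  intro hk
  obtain ⟨μ, v, hv, hkv⟩ := exists_eigenvector_of_isAlgebraic hk
  have hμ : μ ≠ 0 := by
    rintro rfl
    rw [zero_smul, h.isUnit_k.mul_right_eq_zero] at hkv
    exact hv hkv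
  have hsq {x : ℂ} {u : R} (hu : x • (k * u) = μ • u) : x ^ 2 • (k * k * u) = μ ^ 2 • u := by
    rw [pow_two, mul_smul, mul_assoc, ← mul_smul_comm, hu, mul_smul_comm, smul_comm, hu,
      smul_smul, pow_two]
  obtain ⟨n, u, hu0, hku, hau⟩ := exists_eigenvector_mul_eq_zero (h.ak_inv hp) (inv_ne_zero hp)
    (fun n hn => by simpa using hp1 n hn) hk hμ hv hkv
  obtain ⟨m, w, hw0, hkw, hbw⟩ := exists_eigenvector_mul_eq_zero h.bk hp hp1 hk hμ hv hkv
  have hcu : c * u = u := by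
    have := congrArg (· * u) h.ba
    simp only [smul_mul_assoc, mul_assoc, hau, mul_zero, smul_zero, sub_mul, one_mul] at this
    exact (sub_eq_zero.mp this.symm).symm
  have hcw : p ^ 2 • (c * w) = w := by
    have := congrArg (· * w) h.ab
    simp only [smul_mul_assoc, mul_assoc, hbw, mul_zero, smul_zero, sub_mul, one_mul] at this
    exact (sub_eq_zero.mp this.symm).symm
  have hkku : k * k * u = u := by
    conv_lhs => rw [← hcu]
    rw [← mul_assoc, h.k2c, one_mul]
  have hkkw : k * k * w = p ^ 2 • w := by
    conv_lhs => rw [← hcw]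
    rw [mul_smul_comm, ← mul_assoc, h.k2c, one_mul]
  have h1 := hsq hku
  have h2 := hsq hkw
  rw [hkku] at h1
  rw [hkkw, smul_smul] at h2
  have h1' := smul_left_injective ℂ hu0 h1
  have h2' := smul_left_injective ℂ hw0 h2
  refine hp1 (2 * n + 2 * m + 2) (by omega) ?_
  have hpn : (p⁻¹ ^ n) ^ 2 * p ^ (2 * n) = 1 := by
    rw [← pow_mul, mul_comm n, ← mul_pow, inv_mul_cancel₀ hp, one_pow]
  rw [← hpn, h1', ← h2']
  ring

/-- The ladder monomials: powers of `a` in nonnegative degree, powers of `b` in negative degree. -/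
def ladder (a b : R) : ℤ → R
  | Int.ofNat n => a ^ n
  | Int.negSucc n => b ^ (n + 1)

theorem ladder_mul_k (h : IsQOscillator p k a b c) (hp : p ≠ 0) (n : ℤ) :
    ladder a b n * k = p⁻¹ ^ n • (k * ladder a b n) := by
  cases n with
  | ofNat n => simpa [ladder] using pow_mul_of_qCommute (h.ak_inv hp) n
  | negSucc n => simpa [ladder] using pow_mul_of_qCommute h.bk (n + 1)

theorem eq_zero_of_aeval_mul_ladder_eq_zero [Nontrivial R] (h : IsQOscillator p k a b c)
    (hp : p ≠ 0) (hp1 : ∀ n : ℕ, n ≠ 0 → p ^ n ≠ 1) (n : ℤ) {f : ℂ[X]}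
    (hf : aeval k f * ladder a b n = 0) : f = 0 := by
  have hk := h.transcendental_k hp hp1
  have hq : (1 - p ^ 2) ≠ 0 := sub_ne_zero.mpr (hp1 2 (by norm_num)).symm
  have hab : a * b * (k * k) = (1 - p ^ 2)⁻¹ • (k * k) - ((1 - p ^ 2)⁻¹ * p ^ 2) • 1 := by
    rw [← inv_smul_smul₀ hq (a * b), h.ab, smul_mul_assoc, sub_mul, smul_mul_assoc, h.ckk,
      one_mul, smul_sub, smul_smul]
  have hba : b * a * (k * k) = (1 - p ^ 2)⁻¹ • (k * k) - (1 - p ^ 2)⁻¹ • 1 := by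
    rw [← inv_smul_smul₀ hq (b * a), h.ba, smul_mul_assoc, sub_mul, h.ckk, one_mul, smul_sub]
  cases n with
  | ofNat n =>
    exact eq_zero_of_aeval_mul_pow_eq_zero (h.ak_inv hp) hk
      (mul_ne_zero (inv_ne_zero hq) (pow_ne_zero 2 hp)) hab n hf
  | negSucc n =>
    exact eq_zero_of_aeval_mul_pow_eq_zero h.bk hk (inv_ne_zero hq) hba (n + 1) hf

/-- The elements of the form `k⁻ᵐ f(k)` times the ladder monomial of degree `n`. -/
def weightSpace (k a b : R) (n : ℤ) : Submodule ℂ R where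
  carrier := {y | ∃ (m : ℕ) (f : ℂ[X]), k ^ m * y = aeval k f * ladder a b n}
  zero_mem' := ⟨0, 0, by simp⟩
  smul_mem' := by
    rintro x y ⟨m, f, hf⟩
    exact ⟨m, x • f, by simp [hf]⟩
  add_mem' := by
    rintro y z ⟨m, f, hf⟩ ⟨l, g, hg⟩
    refine ⟨m + l, X ^ l * f + X ^ m * g, ?_⟩
    have h1 : k ^ (m + l) * y = k ^ l * (k ^ m * y) := by rw [← mul_assoc, ← pow_add, add_comm]
    have h2 : k ^ (m + l) * z = k ^ m * (k ^ l * z) := by rw [← mul_assoc, ← pow_add]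
    rw [mul_add, h1, h2, hf, hg]
    simp [add_mul, mul_assoc]

theorem k_mul_mem {n : ℤ} {y : R} (hy : y ∈ weightSpace k a b n) :
    k * y ∈ weightSpace k a b n := by
  obtain ⟨m, f, hf⟩ := hy
  refine ⟨m, X * f, ?_⟩
  rw [← mul_assoc, ← pow_succ, pow_succ', mul_assoc, hf, map_mul, aeval_X, mul_assoc]

theorem c_mul_mem (h : IsQOscillator p k a b c) {n : ℤ} {y : R}
    (hy : y ∈ weightSpace k a b n) : c * y ∈ weightSpace k a b n := by
  obtain ⟨m, f, hf⟩ := hy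
  refine ⟨m + 2, f, ?_⟩
  rw [pow_add, pow_two, mul_assoc, ← mul_assoc (k * k), h.k2c, one_mul, hf]

theorem mul_mem_of_qCommute {e : R} {s : ℂ} (he : e * k = s • (k * e)) (hs : s ≠ 0) {n l : ℤ}
    (hel : e * ladder a b n ∈ weightSpace k a b l) {y : R} (hy : y ∈ weightSpace k a b n) :
    e * y ∈ weightSpace k a b l := by
  obtain ⟨m, f, hf⟩ := hy
  obtain ⟨r, g, hg⟩ := hel
  refine ⟨r + m, (s ^ m)⁻¹ • (f.comp (C s * X) * g), ?_⟩
  have h1 : k ^ m * e = (s ^ m)⁻¹ • (e * k ^ m) := by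
    rw [mul_pow_of_qCommute he, inv_smul_smul₀ (pow_ne_zero m hs)]
  have h2 : Commute (k ^ r) (aeval k (f.comp (C s * X))) := by
    have : k ^ r = aeval k (X ^ r : ℂ[X]) := by simp
    rw [this]
    exact (Commute.all _ _).map (aeval k)
  rw [pow_add, mul_assoc, ← mul_assoc (k ^ m), h1, smul_mul_assoc, mul_assoc, hf, ← mul_assoc e,
    mul_aeval_of_qCommute he, mul_smul_comm, mul_assoc, ← mul_assoc (k ^ r), h2.eq, mul_assoc, hg,
    map_smul, smul_mul_assoc, map_mul, mul_assoc]

theorem ladder_mem (n : ℤ) : ladder a b n ∈ weightSpace k a b n := ⟨0, 1, by simp⟩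

theorem a_mul_mem (h : IsQOscillator p k a b c) (hp : p ≠ 0) (hq : 1 - p ^ 2 ≠ 0) {n : ℤ} {y : R}
    (hy : y ∈ weightSpace k a b n) : a * y ∈ weightSpace k a b (n + 1) := by
  refine mul_mem_of_qCommute (h.ak_inv hp) (inv_ne_zero hp) ?_ hy
  cases n with
  | ofNat n =>
    have := ladder_mem (k := k) (a := a) (b := b) (Int.ofNat (n + 1))
    rwa [ladder, pow_succ'] at this
  | negSucc n =>
    have hl : ladder a b (Int.negSucc n + 1) = b ^ n := by
      cases n with
      | zero => simp [ladder]
      | succ n => rw [show Int.negSucc (n + 1) + 1 = Int.negSucc n by omega, ladder]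
    have hm := ladder_mem (k := k) (a := a) (b := b) (Int.negSucc n + 1)
    rw [ladder, pow_succ', ← mul_assoc, ← inv_smul_smul₀ hq (a * b), h.ab, smul_mul_assoc, sub_mul,
      smul_mul_assoc, one_mul, ← hl]
    exact Submodule.smul_mem _ _ (Submodule.sub_mem _ hm (Submodule.smul_mem _ _ (h.c_mul_mem hm)))

theorem b_mul_mem (h : IsQOscillator p k a b c) (hp : p ≠ 0) (hq : 1 - p ^ 2 ≠ 0) {n : ℤ} {y : R}
    (hy : y ∈ weightSpace k a b n) : b * y ∈ weightSpace k a b (n - 1) := by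
  refine mul_mem_of_qCommute h.bk hp ?_ hy
  have hm := ladder_mem (k := k) (a := a) (b := b) (n - 1)
  cases n with
  | negSucc n =>
    rw [show Int.negSucc n - 1 = Int.negSucc (n + 1) by omega] at hm ⊢
    rwa [ladder, pow_succ'] at hm
  | ofNat n =>
    cases n with
    | zero =>
      rw [show Int.ofNat 0 - 1 = Int.negSucc 0 by simp] at hm ⊢
      simpa [ladder] using hm
    | succ n =>
      rw [show Int.ofNat (n + 1) - 1 = Int.ofNat n by simp] at hm ⊢
      rw [ladder, pow_succ', ← mul_assoc, ← inv_smul_smul₀ hq (b * a), h.ba, smul_mul_assoc,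
        sub_mul, one_mul]
      exact Submodule.smul_mem _ _ (Submodule.sub_mem _ hm (h.c_mul_mem hm))

theorem mem_eigenspace (h : IsQOscillator p k a b c) (hp : p ≠ 0) {n : ℤ} {y : R}
    (hy : y ∈ weightSpace k a b n) :
    y ∈ Module.End.eigenspace (LinearMap.mulLeftRight ℂ (k * c, k)) (p⁻¹ ^ n) := by
  obtain ⟨m, f, hf⟩ := hy
  rw [Module.End.mem_eigenspace_iff, LinearMap.mulLeftRight_apply]
  have h1 : k ^ m * (y * k) = p⁻¹ ^ n • (k ^ m * (k * y)) := by
    have hfk : aeval k f * k = k * aeval k f := by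
      simpa using ((Commute.all f X).map (aeval k)).eq
    rw [← mul_assoc, hf, mul_assoc, h.ladder_mul_k hp, mul_smul_comm, ← mul_assoc (aeval k f), hfk,
      ← mul_assoc (k ^ m), ← pow_succ, pow_succ', mul_assoc k (k ^ m), hf, mul_assoc]
  rw [← mul_smul_comm] at h1
  have h2 := (h.isUnit_k.pow m).mul_left_cancel h1
  rw [mul_assoc, h2, mul_smul_comm, ← mul_assoc, mul_assoc k c, h.ck, ← mul_assoc, h.k2c, one_mul]

end IsQOscillator

theorem isQOscillator_generators (p : ℂ) : IsQOscillator p (pK p) (pA p) (pB p) (pC p) where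
  ab := by simpa [pA, pB, pC] using RingQuot.mkAlgHom_rel ℂ (PRel.ab (p := p))
  ba := by simpa [pA, pB, pC] using RingQuot.mkAlgHom_rel ℂ (PRel.ba (p := p))
  ak := by simpa [pA, pK] using RingQuot.mkAlgHom_rel ℂ (PRel.ak (p := p))
  bk := by simpa [pB, pK] using RingQuot.mkAlgHom_rel ℂ (PRel.bk (p := p))
  ck := by simpa [pC, pK] using RingQuot.mkAlgHom_rel ℂ (PRel.ck (p := p))
  k2c := by simpa [pC, pK] using RingQuot.mkAlgHom_rel ℂ (PRel.k2c (p := p))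

namespace IsQOscillator

theorem map {R S : Type*} [Ring R] [Algebra ℂ R] [Ring S] [Algebra ℂ S] {p : ℂ} {k a b c : R}
    (h : IsQOscillator p k a b c) (φ : R →ₐ[ℂ] S) :
    IsQOscillator p (φ k) (φ a) (φ b) (φ c) where
  ab := by simpa using congrArg φ h.ab
  ba := by simpa using congrArg φ h.ba
  ak := by simpa using congrArg φ h.ak
  bk := by simpa using congrArg φ h.bk
  ck := by simpa using congrArg φ h.ck
  k2c := by simpa using congrArg φ h.k2c

theorem map_ladder {R S : Type*} [Ring R] [Algebra ℂ R] [Ring S] [Algebra ℂ S] (a b : R)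
    (φ : R →ₐ[ℂ] S) (n : ℤ) : φ (ladder a b n) = ladder (φ a) (φ b) n := by
  cases n <;> simp [ladder]

end IsQOscillator

open IsQOscillator

theorem iSup_weightSpace_eq_top {p : ℂ} (hp : p ≠ 0) (hq : 1 - p ^ 2 ≠ 0) :
    ⨆ n, weightSpace (pK p) (pA p) (pB p) n = ⊤ := by
  have hP := isQOscillator_generators p
  set W := weightSpace (pK p) (pA p) (pB p)
  have hstep {x : PAlg p} (τ : ℤ → ℤ) (hx : ∀ n, ∀ y ∈ W n, x * y ∈ W (τ n)) :
      ∀ y ∈ ⨆ n, W n, x * y ∈ ⨆ n, W n := by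
    intro y hy
    refine Submodule.iSup_induction W (motive := fun y => x * y ∈ ⨆ n, W n) hy
      (fun n y hy => Submodule.mem_iSup_of_mem (τ n) (hx n y hy)) (by simp) fun y z hy hz => ?_
    rw [mul_add]
    exact Submodule.add_mem _ hy hz
  have hmul (x : PAlg p) : ∀ y ∈ ⨆ n, W n, x * y ∈ ⨆ n, W n := by
    obtain ⟨z, rfl⟩ := RingQuot.mkAlgHom_surjective ℂ (PRel p) x
    induction z using FreeAlgebra.induction with
    | grade0 r =>
      intro y hy
      rw [AlgHom.commutes, ← Algebra.smul_def]
      exact Submodule.smul_mem _ _ hy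
    | grade1 g =>
      cases g with
      | K => exact hstep id fun n y hy => k_mul_mem hy
      | A => exact hstep (· + 1) fun n y hy => hP.a_mul_mem hp hq hy
      | B => exact hstep (· - 1) fun n y hy => hP.b_mul_mem hp hq hy
      | C => exact hstep id fun n y hy => hP.c_mul_mem hy
    | mul z w hz hw =>
      intro y hy
      rw [map_mul, mul_assoc]
      exact hz _ (hw _ hy)
    | add z w hz hw =>
      intro y hy
      rw [map_add, add_mul]
      exact Submodule.add_mem _ (hz y hy) (hw y hy)
  have hone : (1 : PAlg p) ∈ ⨆ n, W n :=
    Submodule.mem_iSup_of_mem 0 ⟨0, 1, by simp [ladder]⟩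
  exact eq_top_iff.mpr fun x _ => by simpa using hmul x 1 hone

/-- Every homomorphism from `PAlg p` to a nontrivial algebra is injective when `p` is nonzero and
not a root of unity. -/
theorem injective_of_nontrivial {p : ℂ} (hp : p ≠ 0) (hp1 : ∀ n : ℕ, n ≠ 0 → p ^ n ≠ 1)
    {R : Type*} [Ring R] [Algebra ℂ R] [Nontrivial R] (φ : PAlg p →ₐ[ℂ] R) :
    Function.Injective φ := by
  have hP := isQOscillator_generators p
  have hR := hP.map φ
  refine (injective_iff_map_eq_zero φ).mpr fun x hx => ?_
  have hxt : x ∈ ⨆ n, weightSpace (pK p) (pA p) (pB p) n := by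
    rw [iSup_weightSpace_eq_top hp (sub_ne_zero.mpr (hp1 2 (by norm_num)).symm)]
    trivial
  obtain ⟨y, hy, rfl⟩ := (Submodule.mem_iSup_iff_exists_finsupp _ _).mp hxt
  have hinj : Function.Injective fun n : ℤ => p⁻¹ ^ n :=
    zpow_injective_of_pow_ne_one (inv_ne_zero hp) fun n hn => by simpa using hp1 n hn
  have hind := (Module.End.eigenspaces_iSupIndep
    (LinearMap.mulLeftRight ℂ (φ (pK p) * φ (pC p), φ (pK p)))).comp hinj
  have hmap {n : ℤ} {z : PAlg p} (hz : z ∈ weightSpace (pK p) (pA p) (pB p) n) :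
      φ z ∈ weightSpace (φ (pK p)) (φ (pA p)) (φ (pB p)) n := by
    obtain ⟨m, f, hf⟩ := hz
    refine ⟨m, f, ?_⟩
    rw [← map_pow, ← map_mul, hf, map_mul, map_ladder, aeval_algHom_apply]
  have hzero : ∀ n ∈ y.support, φ (y n) = 0 :=
    (iSupIndep_iff_finsetSum_eq_zero_imp_eq_zero _).mp hind y.support (fun n => φ (y n))
      (fun n _ => hR.mem_eigenspace hp (hmap (hy n))) (by rwa [Finsupp.sum, map_sum] at hx)
  refine Finset.sum_eq_zero fun n hn => ?_
  obtain ⟨m, f, hf⟩ := hy n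
  have hf0 : f = 0 := by
    refine hR.eq_zero_of_aeval_mul_ladder_eq_zero hp hp1 n ?_
    rw [← map_ladder, aeval_algHom_apply, ← map_mul, ← hf, map_mul, hzero n hn, mul_zero]
  rw [hf0, map_zero, zero_mul, (hP.isUnit_k.pow m).mul_right_eq_zero] at hf
  exact hf

/-- Let `𝒜` be a unital associative `ℂ`-algebra and `Ψ : P → 𝒜` a
unital `ℂ`-algebra homomorphism such that `Ψ(C)^M ≠ 0` for every positive integer `M`
(with `p = e^{-ω}`, `ω > 0`).  Then `Ψ` is injective. -/
theorem statement_12 (ω : ℝ) (hω : 0 < ω)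
    {𝒜 : Type*} [Ring 𝒜] [Algebra ℂ 𝒜]
    (Ψ : PAlg (Real.exp (-ω) : ℂ) →ₐ[ℂ] 𝒜)
    (hC : ∀ M : ℕ, 1 ≤ M → Ψ (pC (Real.exp (-ω) : ℂ)) ^ M ≠ 0) :
    Function.Injective Ψ := by
  have : Nontrivial 𝒜 := nontrivial_of_ne _ _ (hC 1 le_rfl)
  refine injective_of_nontrivial (by exact_mod_cast (Real.exp_pos _).ne') (fun n hn h1 => ?_) Ψ
  have h2 : Real.exp (-ω) ^ n = 1 := by exact_mod_cast h1
  exact (pow_lt_one₀ (Real.exp_pos _).le (by simpa using hω) hn).ne h2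
end
end
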